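/- Let G be a discrete finitely generated group and let ←G = lim_{←n}(G/Γ_n, π_n) be any subodometer of G. Then there exists a Toeplitz array x ∈ {0,1}^G and an almost 1-1 factor map from the Toeplitz system (Ω_G(x), G) onto (←G, G); in particular, ←G is the maximal equicontinuous factor of (Ω_G(x), G). -/

import Mathlib

open Pointwise MeasureTheory

/-- Compatibility condition defining the inverse limit `lim_{←i} (G/Γᵢ, πᵢ)`:
a sequence of cosets is compatible if any representative of the `(i+1)`-th coordinate
also represents the `i`-th coordinate. -/
def Compat {G : Type*} [Group G] (Γ : ℕ → Subgroup G) (x : ∀ i, G ⧸ Γ i) : Prop :=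
  ∀ (i : ℕ) (g : G),
    (QuotientGroup.mk g : G ⧸ Γ (i + 1)) = x (i + 1) →
    (QuotientGroup.mk g : G ⧸ Γ i) = x i

/-- The subodometer `←G = lim_{←i} (G/Γᵢ, πᵢ)` associated to a sequence of subgroups. -/
def Subodometer {G : Type*} [Group G] (Γ : ℕ → Subgroup G) : Type _ :=
  { x : ∀ i, G ⧸ Γ i // Compat Γ x }

/-- Topology of the subodometer: subspace topology of the product of the (discrete)
coset spaces. -/
instance {G : Type*} [Group G] (Γ : ℕ → Subgroup G) [TopologicalSpace G] :
    TopologicalSpace (Subodometer Γ) :=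
  instTopologicalSpaceSubtype

lemma compat_smul {G : Type*} [Group G] (Γ : ℕ → Subgroup G) (g : G) (x : ∀ i, G ⧸ Γ i)
    (hx : Compat Γ x) : Compat Γ (fun i => g • x i) := by
  intro i h hh
  change (QuotientGroup.mk h : G ⧸ Γ (i + 1)) = g • x (i + 1) at hh
  show (QuotientGroup.mk h : G ⧸ Γ i) = g • x i
  obtain ⟨a, ha⟩ := QuotientGroup.mk_surjective (x (i + 1))
  have h1 : (QuotientGroup.mk (g * a) : G ⧸ Γ (i + 1)) = g • x (i + 1) := by
    rw [← ha]; rfl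
  rw [← h1] at hh
  have h2 : (QuotientGroup.mk (g⁻¹ * h) : G ⧸ Γ (i + 1)) = QuotientGroup.mk a := by
    rw [QuotientGroup.eq] at hh ⊢
    simpa [mul_assoc] using hh
  have h3 := hx i _ (h2.trans ha)
  have h4 : (QuotientGroup.mk (g * (g⁻¹ * h)) : G ⧸ Γ i) = g • x i := by
    rw [show (QuotientGroup.mk (g * (g⁻¹ * h)) : G ⧸ Γ i)
        = g • (QuotientGroup.mk (g⁻¹ * h) : G ⧸ Γ i) from rfl, h3]
  simpa [mul_assoc] using h4

/-- The action of `G` on the subodometer by coordinatewise left multiplication. -/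
instance {G : Type*} [Group G] (Γ : ℕ → Subgroup G) : MulAction G (Subodometer Γ) where
  smul g x := ⟨fun i => g • x.1 i, compat_smul Γ g x.1 x.2⟩
  one_smul x := Subtype.ext (funext fun i => one_smul G (x.1 i))
  mul_smul g h x := Subtype.ext (funext fun i => mul_smul g h (x.1 i))

/-- The distinguished point `e` of the subodometer: the sequence of cosets of the
neutral element. -/
def odoE {G : Type*} [Group G] (Γ : ℕ → Subgroup G) (hΓ : ∀ i, Γ (i + 1) ≤ Γ i) :
    Subodometer Γ :=
  ⟨fun i => QuotientGroup.mk 1, by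
    intro i g hg
    rw [QuotientGroup.eq] at hg ⊢
    exact hΓ i hg⟩

/-- The canonical map `τ : G → ←G`, `τ(g) = (gΓᵢ)ᵢ`. -/
def odoTau {G : Type*} [Group G] (Γ : ℕ → Subgroup G) (hΓ : ∀ i, Γ (i + 1) ≤ Γ i) (g : G) :
    Subodometer Γ :=
  ⟨fun i => QuotientGroup.mk g, by
    intro i h hh
    rw [QuotientGroup.eq] at hh ⊢
    exact hΓ i hh⟩

/-- A factor map between two `G`-systems: a continuous surjection commuting with the
`G`-actions. -/
def IsFactorMap (G : Type*) {X Y : Type*} [Group G] [TopologicalSpace X] [TopologicalSpace Y]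
    [MulAction G X] [MulAction G Y] (π : X → Y) : Prop :=
  Continuous π ∧ Function.Surjective π ∧ ∀ (g : G) (x : X), π (g • x) = g • π x

/-- The (left) shift action of `G` on `K^G`: `(γ • x) g = x (g γ)`. -/
instance shiftMulAction (G K : Type*) [Group G] : MulAction G (G → K) where
  smul γ x := fun g => x (g * γ)
  one_smul x := funext fun g => congrArg x (mul_one g)
  mul_smul γ δ x := funext fun g => (congrArg x (mul_assoc g γ δ)).symm

/-- `Per(x, Γ, σ) = {g ∈ G : x (g γ) = σ for all γ ∈ Γ}`. -/
def PerSet {G A : Type*} [Group G] (x : G → A) (Γ : Subgroup G) (σ : A) : Set G :=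
  {g : G | ∀ γ ∈ Γ, x (g * γ) = σ}

/-- `Per(x, Γ) = ⋃_σ Per(x, Γ, σ)`. -/
def Per {G A : Type*} [Group G] (x : G → A) (Γ : Subgroup G) : Set G :=
  ⋃ σ : A, PerSet x Γ σ

/-- `x` is a `G`-Toeplitz array if every `g ∈ G` belongs to `Per(x, Γ)` for some
finite-index subgroup `Γ`. -/
def IsToeplitz {G A : Type*} [Group G] (x : G → A) : Prop :=
  ∀ g : G, ∃ Γ : Subgroup G, Γ.FiniteIndex ∧ g ∈ Per x Γ

/-- `Γ` is an essential group of periods of `x`: every `g ∈ G` with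
`Per(x, Γ, σ) ⊆ Per(g • x, Γ, σ)` for all `σ` belongs to `Γ`. -/
def IsEssentialPeriodGroup {G A : Type*} [Group G] (x : G → A) (Γ : Subgroup G) : Prop :=
  ∀ g : G, (∀ σ : A, PerSet x Γ σ ⊆ PerSet (g • x) Γ σ) → g ∈ Γ

/-- `Ω_G(x)`: the closure of the `G`-orbit of `x` in `A^G`. -/
def OmegaG (G : Type*) {A : Type*} [Group G] [TopologicalSpace A] (x : G → A) : Set (G → A) :=
  closure (Set.range fun g : G => g • x)

lemma smul_mem_omegaG (G : Type*) {A : Type*} [Group G] [TopologicalSpace A] {x z : G → A}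
    (g : G) (hz : z ∈ OmegaG G x) : g • z ∈ OmegaG G x := by
  unfold OmegaG at hz ⊢
  have hc : Continuous fun w : G → A => g • w := continuous_pi fun h => continuous_apply (h * g)
  have himg : (fun w : G → A => g • w) '' (Set.range fun h : G => h • x)
      = Set.range fun h : G => h • x := by
    ext w; constructor
    · rintro ⟨_, ⟨h, rfl⟩, rfl⟩
      refine ⟨g * h, ?_⟩
      show (g * h) • x = g • (h • x)
      rw [mul_smul]
    · rintro ⟨h, rfl⟩
      refine ⟨(g⁻¹ * h) • x, ⟨g⁻¹ * h, rfl⟩, ?_⟩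
      show g • ((g⁻¹ * h) • x) = h • x
      rw [← mul_smul, mul_inv_cancel_left]
  have h1 : g • z ∈ (fun w : G → A => g • w) '' closure (Set.range fun h : G => h • x) :=
    ⟨z, hz, rfl⟩
  have h2 := image_closure_subset_closure_image (f := fun w : G → A => g • w)
    (s := Set.range fun h : G => h • x) hc
  rw [himg] at h2
  exact h2 h1

lemma self_mem_omegaG (G : Type*) {A : Type*} [Group G] [TopologicalSpace A] (x : G → A) :
    x ∈ OmegaG G x :=
  subset_closure ⟨1, one_smul G x⟩

/-- The subshift `Ω_G(x)` as a topological dynamical system. -/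
def OmegaSub (G : Type*) {A : Type*} [Group G] [TopologicalSpace A] (x : G → A) : Type _ :=
  { z : G → A // z ∈ OmegaG G x }

instance (G : Type*) {A : Type*} [Group G] [TopologicalSpace A] (x : G → A) :
    TopologicalSpace (OmegaSub G x) :=
  instTopologicalSpaceSubtype

instance (G : Type*) {A : Type*} [Group G] [TopologicalSpace A] (x : G → A) :
    MulAction G (OmegaSub G x) where
  smul g z := ⟨g • z.1, smul_mem_omegaG G g z.2⟩
  one_smul z := Subtype.ext (one_smul G z.1)
  mul_smul a b z := Subtype.ext (mul_smul a b z.1)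

/-- An equicontinuous `G`-system on a metric space `Y`. -/
def IsEquicontinuousSystem (G Y : Type*) [Group G] [PseudoMetricSpace Y] [MulAction G Y] :
    Prop :=
  ∀ ε : ℝ, 0 < ε → ∃ δ : ℝ, 0 < δ ∧
    ∀ y z : Y, dist y z < δ → ∀ g : G, dist (g • y) (g • z) < ε

open Topology

section Construction

variable {G : Type*} [Group G]

/-- A finitely generated group is countable. -/
theorem countable_of_group_fg (G : Type*) [Group G] [Group.FG G] : Countable G := by
  obtain ⟨S, hS, φ, hφ⟩ := Group.fg_iff_exists_freeGroup_hom_surjective.1 ‹Group.FG G›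
  have : Finite S := hS
  have : Countable (FreeGroup S) :=
    Function.Surjective.countable (f := FreeGroup.mk) Quot.mk_surjective
  exact hφ.countable

/-- A subgroup of relative index at least three splits every coset of the bigger subgroup into
at least three smaller ones; one of them can be chosen to avoid a prescribed coset. -/
theorem exists_three_cosets {H K : Subgroup G} (h : 2 < K.relIndex H) (b g : G) :
    ∃ b' a c : G, b⁻¹ * b' ∈ H ∧ b⁻¹ * a ∈ H ∧ b⁻¹ * c ∈ H ∧ g⁻¹ * b' ∉ K ∧
      b'⁻¹ * a ∉ K ∧ b'⁻¹ * c ∉ K ∧ a⁻¹ * c ∉ K := by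
  have hcard : 2 < Nat.card (H ⧸ K.subgroupOf H) := h
  have : Finite (H ⧸ K.subgroupOf H) := Nat.finite_of_card_ne_zero (by omega)
  have := Fintype.ofFinite (H ⧸ K.subgroupOf H)
  rw [Nat.card_eq_fintype_card, Fintype.two_lt_card_iff] at hcard
  obtain ⟨u, v, w, huv, huw, hvw⟩ := hcard
  induction u using QuotientGroup.induction_on with | _ u
  induction v using QuotientGroup.induction_on with | _ v
  induction w using QuotientGroup.induction_on with | _ w
  rw [Ne, QuotientGroup.eq, Subgroup.mem_subgroupOf] at huv huw hvw
  push_cast at huv huw hvw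
  have hvu : (v : G)⁻¹ * u ∉ K := fun hk => huv (by simpa using K.inv_mem hk)
  by_cases hg : g⁻¹ * (b * u) ∈ K
  · refine ⟨b * v, b * u, b * w, by simp, by simp, by simp, fun hk => ?_, ?_, ?_, ?_⟩
    · exact huv (by simpa [mul_assoc] using K.mul_mem (K.inv_mem hg) hk)
    all_goals simpa [mul_assoc]
  · refine ⟨b * u, b * v, b * w, by simp, by simp, by simp, hg, ?_, ?_, ?_⟩
    all_goals simpa [mul_assoc]

/-- If `t⁻¹ K t ≤ K` for a finite-index subgroup `K`, then also `t K t⁻¹ ≤ K`. -/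
theorem conj_mem_of_conj_inv_mem {K : Subgroup G} (hK : K.FiniteIndex) {t : G}
    (ht : ∀ δ ∈ K, t⁻¹ * δ * t ∈ K) {κ : G} (hκ : κ ∈ K) : t * κ * t⁻¹ ∈ K := by
  obtain ⟨j, hj, -, hjK⟩ := Subgroup.exists_pow_mem_of_index_ne_zero hK.index_ne_zero t
  obtain ⟨i, rfl⟩ : ∃ i, j = i + 1 := ⟨j - 1, by omega⟩
  have hpow : ∀ i : ℕ, ∀ δ ∈ K, (t ^ i)⁻¹ * δ * t ^ i ∈ K := by
    intro i
    induction i with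
    | zero => simp
    | succ i ih =>
      intro δ hδ
      have := ht _ (ih δ hδ)
      simpa [pow_succ, mul_assoc] using this
  have := hpow i _ (K.mul_mem (K.mul_mem hjK hκ) (K.inv_mem hjK))
  rw [pow_succ] at this
  simpa [mul_assoc] using this

/-- A decreasing sequence of finite-index subgroups whose successive indices are at least three
and which starts from the whole group admits a `Bool`-valued array which is locally constant for
these subgroups and separates their cosets. -/
theorem exists_separating_array [Countable G] (Δ : ℕ → Subgroup G) (hΔ : Antitone Δ)
    (htop : Δ 0 = ⊤) (hfin : ∀ n, (Δ n).FiniteIndex)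
    (hidx : ∀ n, 2 < (Δ (n + 1)).relIndex (Δ n)) :
    ∃ x : G → Bool, (∀ g, ∃ n, ∀ γ ∈ Δ n, x (g * γ) = x g) ∧
      ∀ n, ∃ M, ∀ γ γ' : G, γ⁻¹ * γ' ∉ Δ n → ∃ f : G,
        (∀ δ ∈ Δ M, x (f * γ * δ) = x (f * γ)) ∧ (∀ δ ∈ Δ M, x (f * γ' * δ) = x (f * γ')) ∧
          x (f * γ) ≠ x (f * γ') := by
  classical
  obtain ⟨enum, henum⟩ := exists_surjective_nat G
  choose nextB nextA nextC hB hA hC hg hBA hBC hAC using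
    fun (m : ℕ) (b : G) => exists_three_cosets (hidx m) b (enum m)
  let b : ℕ → G := fun m => Nat.rec 1 nextB m
  let a : ℕ → G := fun m => nextA m (b m)
  let c : ℕ → G := fun m => nextC m (b m)
  have hbsucc : ∀ m, b (m + 1) = nextB m (b m) := fun m => rfl
  let B : ℕ → Set G := fun m => {g | (b m)⁻¹ * g ∈ Δ m}
  let A : ℕ → Set G := fun m => {g | (a m)⁻¹ * g ∈ Δ (m + 1)}
  have hBanti : Antitone B := by
    refine antitone_nat_of_succ_le fun m g hg' => ?_
    have h1 : (b m)⁻¹ * b (m + 1) ∈ Δ m := hB m (b m)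
    simpa [B, mul_assoc] using (Δ m).mul_mem h1 (hΔ m.le_succ hg')
  have hAB : ∀ m, A m ⊆ B m \ B (m + 1) := by
    intro m g hg'
    refine ⟨?_, fun hgB => ?_⟩
    · have h1 : (b m)⁻¹ * a m ∈ Δ m := hA m (b m)
      simpa [B, mul_assoc] using (Δ m).mul_mem h1 (hΔ m.le_succ hg')
    · refine hBA m (b m) ?_
      have := (Δ (m + 1)).mul_mem hgB ((Δ (m + 1)).inv_mem hg')
      simpa [mul_assoc, hbsucc, a] using this
  let x : G → Bool := fun g => decide (∃ m, g ∈ A m)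
  have hx : ∀ m, ∀ g ∈ B m \ B (m + 1), (x g = true ↔ g ∈ A m) := by
    rintro m g ⟨hg1, hg2⟩
    simp only [x, decide_eq_true_eq]
    refine ⟨?_, fun h => ⟨m, h⟩⟩
    rintro ⟨j, hj⟩
    rcases lt_trichotomy j m with h | rfl | h
    · exact absurd (hBanti h hg1) (hAB j hj).2
    · exact hj
    · exact absurd (hBanti h (hAB j hj).1) hg2
  have hBmul : ∀ m, ∀ δ ∈ Δ m, ∀ g, g * δ ∈ B m ↔ g ∈ B m := by
    intro m δ hδ g
    simp only [B, Set.mem_ofPred_eq, ← mul_assoc]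
    exact Subgroup.mul_mem_cancel_right _ hδ
  have hAmul : ∀ m, ∀ δ ∈ Δ (m + 1), ∀ g, g * δ ∈ A m ↔ g ∈ A m := by
    intro m δ hδ g
    simp only [A, Set.mem_ofPred_eq, ← mul_assoc]
    exact Subgroup.mul_mem_cancel_right _ hδ
  have hconst : ∀ m, ∀ g ∈ B m \ B (m + 1), ∀ δ ∈ Δ (m + 1), x (g * δ) = x g := by
    intro m g hg' δ hδ
    have hgδ : g * δ ∈ B m \ B (m + 1) :=
      ⟨(hBmul m δ (hΔ m.le_succ hδ) g).2 hg'.1, fun h => hg'.2 ((hBmul (m + 1) δ hδ g).1 h)⟩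
    rw [Bool.eq_iff_iff, hx m _ hgδ, hx m _ hg', hAmul m δ hδ]
  refine ⟨x, fun g => ?_, fun n => ⟨n + 1, fun γ γ' hγ => ?_⟩⟩
  · obtain ⟨k, rfl⟩ := henum g
    have hnot : enum k ∉ B (k + 1) := fun h => hg k (b k) <| by
      simpa [hbsucc] using (Δ (k + 1)).inv_mem h
    have hex : ∃ m, enum k ∉ B m := ⟨_, hnot⟩
    obtain ⟨m, hm⟩ : ∃ m, Nat.find hex = m + 1 := by
      refine Nat.exists_eq_succ_of_ne_zero fun h0 => ?_
      have := Nat.find_spec hex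
      rw [h0] at this
      simp [B, htop] at this
    refine ⟨m + 1, hconst m _ ⟨?_, hm ▸ Nat.find_spec hex⟩⟩
    exact not_not.1 (Nat.find_min hex (m := m) (by omega))
  · have hex : ∃ m, γ⁻¹ * γ' ∉ Δ m := ⟨n, hγ⟩
    obtain ⟨m, hm⟩ : ∃ m, Nat.find hex = m + 1 := by
      refine Nat.exists_eq_succ_of_ne_zero fun h0 => ?_
      have := Nat.find_spec hex
      simp [h0, htop] at this
    have hmn : m + 1 ≤ n := hm ▸ Nat.find_min' hex hγ
    have ht' : γ⁻¹ * γ' ∉ Δ (m + 1) := hm ▸ Nat.find_spec hex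
    have ht : γ⁻¹ * γ' ∈ Δ m := not_not.1 (Nat.find_min hex (m := m) (by omega))
    obtain ⟨t, rfl⟩ : ∃ t, γ' = γ * t := ⟨γ⁻¹ * γ', by simp⟩
    rw [inv_mul_cancel_left] at ht ht'
    have haA : ∀ δ ∈ Δ (m + 1), a m * δ ∈ A m := fun δ hδ => by simpa [A] using hδ
    -- It suffices to move `t` into a coset on which `x` is known to be `false`.
    suffices hs : ∃ δ ∈ Δ (m + 1), ∃ j ≤ m + 1, a m * δ * t ∈ B j \ B (j + 1) ∧
        a m * δ * t ∉ A j by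
      obtain ⟨δ, hδ, j, hj, hjB, hjA⟩ := hs
      refine ⟨a m * δ * γ⁻¹, ?_, ?_, ?_⟩
      · rw [inv_mul_cancel_right]
        exact fun ε hε => hconst m _ (hAB m (haA δ hδ)) ε (hΔ (by omega) hε)
      · rw [← mul_assoc, inv_mul_cancel_right]
        exact fun ε hε => hconst j _ hjB ε (hΔ (by omega) hε)
      · rw [← mul_assoc, inv_mul_cancel_right]
        intro heq
        exact hjA ((hx j _ hjB).1 (heq ▸ (hx m _ (hAB m (haA δ hδ))).2 (haA δ hδ)))
    by_cases hall : ∀ δ ∈ Δ (m + 1), a m * δ * t ∈ B (m + 1)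
    · have hconj : ∀ δ ∈ Δ (m + 1), t⁻¹ * δ * t ∈ Δ (m + 1) := by
        intro δ hδ
        have h1 := hall 1 (one_mem _)
        have h2 := hall δ hδ
        have := (Δ (m + 1)).mul_mem ((Δ (m + 1)).inv_mem h1) h2
        simpa [mul_assoc] using this
      have hκ : (a m * t)⁻¹ * c (m + 1) ∈ Δ (m + 1) := by
        have h1 : (b (m + 1))⁻¹ * (a m * 1 * t) ∈ Δ (m + 1) := hall 1 (one_mem _)
        have := (Δ (m + 1)).mul_mem ((Δ (m + 1)).inv_mem h1) (hC (m + 1) (b (m + 1)))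
        simpa [mul_assoc, c] using this
      refine ⟨_, conj_mem_of_conj_inv_mem (hfin _) hconj hκ, m + 1, le_rfl, ?_⟩
      have heq : a m * (t * ((a m * t)⁻¹ * c (m + 1)) * t⁻¹) * t = c (m + 1) := by group
      rw [heq]
      exact ⟨⟨hC (m + 1) (b (m + 1)), hBC (m + 1) (b (m + 1))⟩, hAC (m + 1) (b (m + 1))⟩
    · push Not at hall
      obtain ⟨δ, hδ, hδB⟩ := hall
      refine ⟨δ, hδ, m, m.le_succ, ⟨?_, hδB⟩, fun h => ht' ?_⟩
      · have h1 := (Δ m).mul_mem (hA m (b m)) ((Δ m).mul_mem (hΔ m.le_succ hδ) ht)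
        simpa [B, mul_assoc, a] using h1
      · have h1 : δ * t ∈ Δ (m + 1) := by simpa [A, mul_assoc] using h
        exact (Subgroup.mul_mem_cancel_left _ hδ).1 h1

/-- Every decreasing sequence of finite-index subgroups of a countable group admits a
`Bool`-valued array which is locally constant for these subgroups and whose restrictions to finite
windows recognise their cosets. -/
theorem exists_recognizable_array [Countable G] (Γ : ℕ → Subgroup G) (hΓ : Antitone Γ)
    (hfin : ∀ n, (Γ n).FiniteIndex) :
    ∃ x : G → Bool, (∀ g, ∃ n, ∀ γ ∈ Γ n, x (g * γ) = x g) ∧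
      ∀ n, ∃ F : Finset G, ∀ γ γ' : G, (∀ f ∈ F, x (f * γ) = x (f * γ')) →
        (γ : G ⧸ Γ n) = γ' := by
  classical
  suffices hs : ∃ x : G → Bool, (∀ g, ∃ n, ∀ γ ∈ Γ n, x (g * γ) = x g) ∧
      ∀ n, ∃ M, ∀ γ γ' : G, γ⁻¹ * γ' ∉ Γ n → ∃ f : G,
        (∀ δ ∈ Γ M, x (f * γ * δ) = x (f * γ)) ∧ (∀ δ ∈ Γ M, x (f * γ' * δ) = x (f * γ')) ∧
          x (f * γ) ≠ x (f * γ') by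
    obtain ⟨x, h1, h2⟩ := hs
    refine ⟨x, h1, fun n => ?_⟩
    obtain ⟨M, hM⟩ := h2 n
    have := hfin M
    have : Fintype (G ⧸ Γ M) := Fintype.ofFinite _
    have hsep : ∀ p : (G ⧸ Γ M) × (G ⧸ Γ M), ∃ f : G, ∀ γ γ' : G, (γ : G ⧸ Γ M) = p.1 →
        (γ' : G ⧸ Γ M) = p.2 → γ⁻¹ * γ' ∉ Γ n → x (f * γ) ≠ x (f * γ') := by
      rintro ⟨u, v⟩
      by_cases hp : ∃ γ γ' : G, (γ : G ⧸ Γ M) = u ∧ (γ' : G ⧸ Γ M) = v ∧ γ⁻¹ * γ' ∉ Γ n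
      · obtain ⟨γ, γ', rfl, rfl, hγ⟩ := hp
        obtain ⟨f, hl, hr, hne⟩ := hM γ γ' hγ
        refine ⟨f, fun η η' hη hη' _ => ?_⟩
        have e := hl _ (QuotientGroup.eq.1 hη.symm)
        have e' := hr _ (QuotientGroup.eq.1 hη'.symm)
        rw [mul_assoc, mul_inv_cancel_left] at e e'
        rwa [e, e']
      · exact ⟨1, fun γ γ' h h' hne => absurd ⟨γ, γ', h, h', hne⟩ hp⟩
    choose sep hsep using hsep
    refine ⟨Finset.univ.image sep, fun γ γ' hF => ?_⟩
    rw [QuotientGroup.eq]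
    by_contra hne
    exact hsep (γ, γ') γ γ' rfl rfl hne
      (hF _ (Finset.mem_image_of_mem sep (Finset.mem_univ _)))
  by_cases hbdd : ∃ N, ∀ n, N ≤ n → Γ n = Γ N
  · obtain ⟨N, hN⟩ := hbdd
    have hle : ∀ n, Γ N ≤ Γ n := fun n => by
      rcases le_total n N with h | h
      · exact hΓ h
      · exact (hN n h).ge
    refine ⟨fun g => decide (g ∈ Γ N), fun g => ⟨N, fun γ hγ => ?_⟩, fun n => ⟨N, fun γ γ' h => ?_⟩⟩
    · simp [Subgroup.mul_mem_cancel_right _ hγ]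
    · refine ⟨γ⁻¹, fun δ hδ => ?_, fun δ hδ => ?_, ?_⟩
      · simp [hδ]
      · simp [Subgroup.mul_mem_cancel_right _ hδ]
      · simpa using fun h' => h (hle n h')
  · push Not at hbdd
    let Γ' : ℕ → Subgroup G := fun n => Nat.casesOn n ⊤ Γ
    have hΓ' : Antitone Γ' := antitone_nat_of_succ_le fun n => by
      cases n with
      | zero => exact le_top
      | succ n => exact hΓ n.le_succ
    have hfin' : ∀ n, (Γ' n).FiniteIndex := fun n => by
      cases n with
      | zero => exact inferInstanceAs (⊤ : Subgroup G).FiniteIndex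
      | succ n => exact hfin n
    have hlt : ∀ n, ∃ k, n < k ∧ 1 < (Γ' k).relIndex (Γ' n) := fun n => by
      obtain ⟨k, hk, hne⟩ := hbdd n
      have hfk := hfin' (k + 1)
      have h0 : (Γ' (k + 1)).relIndex (Γ' n) ≠ 0 := Subgroup.FiniteIndex.index_ne_zero
      have h1 : (Γ' (k + 1)).relIndex (Γ' n) ≠ 1 := fun h => by
        rw [Subgroup.relIndex_eq_one] at h
        exact hne (le_antisymm (hΓ hk) ((hΓ' n.le_succ).trans h))
      exact ⟨k + 1, by omega, by omega⟩
    have hlt' : ∀ n, ∃ k, n < k ∧ 2 < (Γ' k).relIndex (Γ' n) := fun n => by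
      obtain ⟨k, hk, hk'⟩ := hlt n
      obtain ⟨l, hl, hl'⟩ := hlt k
      refine ⟨l, hk.trans hl, ?_⟩
      rw [← Subgroup.relIndex_mul_relIndex _ _ _ (hΓ' hl.le) (hΓ' hk.le)]
      nlinarith
    choose next hnext hidx using hlt'
    let φ : ℕ → ℕ := fun m => Nat.rec 0 (fun _ => next) m
    have hφ : StrictMono φ := strictMono_nat_of_lt_succ fun m => hnext (φ m)
    obtain ⟨x, h1, h2⟩ := exists_separating_array (fun m => Γ' (φ m))
      (hΓ'.comp_monotone hφ.monotone) rfl (fun m => hfin' _) (fun m => hidx (φ m))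
    refine ⟨x, fun g => ?_, fun n => ?_⟩
    · obtain ⟨m, hm⟩ := h1 g
      exact ⟨φ m, fun γ hγ => hm γ (hΓ' (φ m).le_succ hγ)⟩
    · obtain ⟨M, hM⟩ := h2 (n + 1)
      refine ⟨φ M, fun γ γ' hγ => ?_⟩
      have hle : Γ' (φ (n + 1)) ≤ Γ n := hΓ' (hφ.id_le (n + 1))
      obtain ⟨f, hl, hr, hne⟩ := hM γ γ' fun h => hγ (hle h)
      exact ⟨f, fun δ hδ => hl δ (hΓ' (φ M).le_succ hδ),
        fun δ hδ => hr δ (hΓ' (φ M).le_succ hδ), hne⟩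

end Construction

section FactorMap

variable {G : Type*} [Group G]

theorem OmegaSub.coe_smul_apply {A : Type*} [TopologicalSpace A] {x : G → A} (g h : G)
    (z : OmegaSub G x) : (g • z).1 h = z.1 (h * g) :=
  rfl

/-- Every point of the orbit closure agrees with a translate of `x` on any given finite window. -/
theorem OmegaSub.exists_eqOn {x : G → Bool} (z : OmegaSub G x) (F : Finset G) :
    ∃ γ : G, ∀ f ∈ F, z.1 f = x (f * γ) := by
  have hopen : IsOpen {w : G → Bool | ∀ f ∈ F, w f = z.1 f} := by
    have : {w : G → Bool | ∀ f ∈ F, w f = z.1 f} = (F : Set G).pi fun f => {z.1 f} := by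
      ext w
      simp [Set.mem_pi]
    rw [this]
    exact isOpen_set_pi F.finite_toSet fun _ _ => isOpen_discrete _
  obtain ⟨_, hw, γ, rfl⟩ := mem_closure_iff.1 z.2 _ hopen fun f _ => rfl
  exact ⟨γ, fun f hf => (hw f hf).symm⟩

instance OmegaSub.compactSpace {x : G → Bool} : CompactSpace (OmegaSub G x) :=
  isCompact_iff_compactSpace.1 (isClosed_closure (s := Set.range fun g : G => g • x)).isCompact

instance Subodometer.t2Space [TopologicalSpace G] [DiscreteTopology G] (Γ : ℕ → Subgroup G) :
    T2Space (Subodometer Γ) := by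
  have : ∀ n, DiscreteTopology (G ⧸ Γ n) := fun n =>
    QuotientGroup.discreteTopology (isOpen_discrete _)
  exact inferInstanceAs (T2Space { x : ∀ i, G ⧸ Γ i // Compat Γ x })

theorem Subodometer.smul_apply {Γ : ℕ → Subgroup G} (g : G) (y : Subodometer Γ) (n : ℕ) :
    (g • y).1 n = g • y.1 n :=
  rfl

/-- If finite windows of `x` recognise the cosets of all `Γ n`, then reading off these cosets
defines a map from the orbit closure of `x` to the subodometer. -/
theorem exists_coset_map {Γ : ℕ → Subgroup G} (hdec : ∀ n, Γ (n + 1) ≤ Γ n) {x : G → Bool}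
    (hrec : ∀ n, ∃ F : Finset G, ∀ γ γ' : G, (∀ f ∈ F, x (f * γ) = x (f * γ')) →
      (γ : G ⧸ Γ n) = γ') :
    ∃ π : OmegaSub G x → Subodometer Γ, ∀ n, ∃ F : Finset G, ∀ (z : OmegaSub G x) (γ : G),
      (∀ f ∈ F, z.1 f = x (f * γ)) → (π z).1 n = γ := by
  classical
  choose F hF using hrec
  choose γ hγ using fun (z : OmegaSub G x) (n : ℕ) => z.exists_eqOn (F n)
  have key : ∀ (z : OmegaSub G x) (n : ℕ) (η : G), (∀ f ∈ F n, z.1 f = x (f * η)) →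
      (γ z n : G ⧸ Γ n) = η := fun z n η hη =>
    hF n _ _ fun f hf => (hγ z n f hf).symm.trans (hη f hf)
  refine ⟨fun z => ⟨fun n => γ z n, fun n g hg => ?_⟩, fun n => ⟨F n, fun z η => key z n η⟩⟩
  obtain ⟨η, hη⟩ := z.exists_eqOn (F n ∪ F (n + 1))
  beta_reduce at hg ⊢
  rw [key z (n + 1) η fun f hf => hη f (Finset.mem_union_right _ hf)] at hg
  rw [key z n η fun f hf => hη f (Finset.mem_union_left _ hf)]
  rw [QuotientGroup.eq] at hg ⊢
  exact hdec n hg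

variable {Γ : ℕ → Subgroup G} {x : G → Bool} {π : OmegaSub G x → Subodometer Γ}

theorem continuous_of_coset_map [TopologicalSpace G]
    (hπ : ∀ n, ∃ F : Finset G, ∀ (z : OmegaSub G x) (γ : G),
      (∀ f ∈ F, z.1 f = x (f * γ)) → (π z).1 n = γ) : Continuous π := by
  refine Continuous.subtype_mk (f := fun z => (π z).1) (continuous_pi fun n => ?_) fun z => (π z).2
  refine IsLocallyConstant.continuous <| (IsLocallyConstant.iff_exists_open _).2 fun z => ?_
  obtain ⟨F, hF⟩ := hπ n
  obtain ⟨γ, hγ⟩ := z.exists_eqOn F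
  refine ⟨{w | ∀ f ∈ F, w.1 f = z.1 f}, ?_, fun f _ => rfl, fun w hw => ?_⟩
  · have : {w : OmegaSub G x | ∀ f ∈ F, w.1 f = z.1 f} = ⋂ f ∈ F, {w | w.1 f = z.1 f} := by
      ext w
      simp
    rw [this]
    refine isOpen_biInter_finset fun f _ => ?_
    have hval : Continuous fun w : OmegaSub G x => w.1 f :=
      (continuous_apply f).comp continuous_subtype_val
    exact (isOpen_discrete {z.1 f}).preimage hval
  · rw [hF z γ hγ, hF w γ fun f hf => (hw f hf).trans (hγ f hf)]

theorem map_smul_of_coset_map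
    (hπ : ∀ n, ∃ F : Finset G, ∀ (z : OmegaSub G x) (γ : G),
      (∀ f ∈ F, z.1 f = x (f * γ)) → (π z).1 n = γ) (g : G) (z : OmegaSub G x) :
    π (g • z) = g • π z := by
  classical
  refine Subtype.ext (funext fun n => ?_)
  obtain ⟨F, hF⟩ := hπ n
  obtain ⟨γ, hγ⟩ := z.exists_eqOn (F ∪ F.image fun f => f * g)
  rw [Subodometer.smul_apply, hF z γ fun f hf => hγ f (Finset.mem_union_left _ hf),
    hF (g • z) (g * γ) fun f hf => ?_]
  · rfl
  · rw [OmegaSub.coe_smul_apply, hγ (f * g)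
      (Finset.mem_union_right _ (Finset.mem_image_of_mem _ hf)), mul_assoc]

theorem Subodometer.apply_eq_of_le {y y' : Subodometer Γ} {m n : ℕ} (hmn : m ≤ n)
    (h : y.1 n = y'.1 n) : y.1 m = y'.1 m := by
  induction n, hmn using Nat.le_induction with
  | base => exact h
  | succ n _ ih =>
    obtain ⟨g, hg⟩ := QuotientGroup.mk_surjective (y.1 (n + 1))
    exact ih ((y.2 n g hg).symm.trans (y'.2 n g (hg.trans h)))

theorem surjective_of_coset_map [TopologicalSpace G] [DiscreteTopology G]
    (hπ : ∀ n, ∃ F : Finset G, ∀ (z : OmegaSub G x) (γ : G),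
      (∀ f ∈ F, z.1 f = x (f * γ)) → (π z).1 n = γ) : Function.Surjective π := by
  intro y
  have hcont := continuous_of_coset_map hπ
  have hdisc : ∀ n, DiscreteTopology (G ⧸ Γ n) := fun n =>
    QuotientGroup.discreteTopology (isOpen_discrete _)
  have hclosed : ∀ n, IsClosed {z | (π z).1 n = y.1 n} := fun n =>
    (isClosed_discrete {y.1 n}).preimage
      ((continuous_apply n).comp (continuous_subtype_val.comp hcont))
  obtain ⟨z, hz⟩ := IsCompact.nonempty_iInter_of_sequence_nonempty_isCompact_isClosed
    (fun n => {z | (π z).1 n = y.1 n})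
    (fun n z hz => Subodometer.apply_eq_of_le n.le_succ hz)
    (fun n => by
      obtain ⟨γ, hγ⟩ := QuotientGroup.mk_surjective (y.1 n)
      obtain ⟨F, hF⟩ := hπ n
      exact ⟨γ • ⟨x, self_mem_omegaG G x⟩, (hF _ γ fun f _ => rfl).trans hγ⟩)
    (hclosed 0).isCompact hclosed
  exact ⟨z, Subtype.ext (funext fun n => Set.mem_iInter.1 hz n)⟩

/-- A point whose coset at a sufficiently deep level is trivial has the same value as `x` at `g`. -/
theorem exists_apply_eq_of_coset_map (hΓ : Antitone Γ)
    (hconst : ∀ g, ∃ n, ∀ γ ∈ Γ n, x (g * γ) = x g)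
    (hπ : ∀ n, ∃ F : Finset G, ∀ (z : OmegaSub G x) (γ : G),
      (∀ f ∈ F, z.1 f = x (f * γ)) → (π z).1 n = γ) (g : G) :
    ∃ N, ∀ n ≥ N, ∀ z, (π z).1 n = (1 : G) → z.1 g = x g := by
  classical
  obtain ⟨N, hN⟩ := hconst g
  refine ⟨N, fun n hn z hz => ?_⟩
  obtain ⟨F, hF⟩ := hπ n
  obtain ⟨γ, hγ⟩ := z.exists_eqOn (insert g F)
  have hmem : γ ∈ Γ n := by
    rw [hF z γ fun f hf => hγ f (Finset.mem_insert_of_mem hf)] at hz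
    simpa using QuotientGroup.eq.1 hz.symm
  rw [hγ g (Finset.mem_insert_self _ _), hN γ (hΓ hn hmem)]

/-- A factor map onto an equicontinuous system identifies points with the same cosets. -/
theorem factor_eq_of_coset_map_eq (hΓ : Antitone Γ)
    (hconst : ∀ g, ∃ n, ∀ γ ∈ Γ n, x (g * γ) = x g)
    (hπ : ∀ n, ∃ F : Finset G, ∀ (z : OmegaSub G x) (γ : G),
      (∀ f ∈ F, z.1 f = x (f * γ)) → (π z).1 n = γ)
    {Y : Type*} [MetricSpace Y] [MulAction G Y] (hY : IsEquicontinuousSystem G Y)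
    {q : OmegaSub G x → Y} (hq : IsFactorMap G q) {z z' : OmegaSub G x} (h : π z = π z') :
    q z = q z' := by
  choose γ hγ using fun n => QuotientGroup.mk_surjective ((π z).1 n)
  have hlim : ∀ w, π w = π z →
      Filter.Tendsto (fun n => (γ n)⁻¹ • w) Filter.atTop (𝓝 ⟨x, self_mem_omegaG G x⟩) := by
    intro w hw
    refine tendsto_subtype_rng.2 (tendsto_pi_nhds.2 fun g => ?_)
    obtain ⟨N, hN⟩ := exists_apply_eq_of_coset_map hΓ hconst hπ g
    refine tendsto_const_nhds.congr' (Filter.eventually_atTop.2 ⟨N, fun n hn => ?_⟩)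
    refine (hN n hn ((γ n)⁻¹ • w) ?_).symm
    rw [map_smul_of_coset_map hπ, Subodometer.smul_apply, hw, ← hγ n]
    change (((γ n)⁻¹ * γ n : G) : G ⧸ Γ n) = _
    rw [inv_mul_cancel]
  refine eq_of_forall_dist_le fun ε hε => ?_
  obtain ⟨δ, hδ, hδε⟩ := hY ε hε
  have hdist := ((hq.1.tendsto _).comp (hlim z rfl)).dist ((hq.1.tendsto _).comp (hlim z' h.symm))
  rw [dist_self] at hdist
  obtain ⟨n, hn⟩ := (hdist.eventually (gt_mem_nhds hδ)).exists
  have := hδε _ _ hn (γ n)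
  simp only [Function.comp_apply, hq.2.2, smul_inv_smul] at this
  exact this.le

end FactorMap

/-- Theorem `01`: for every subodometer `←G` there is a Toeplitz array
`x ∈ {0,1}^G` and an almost 1-1 factor map from `(Ω_G(x), G)` onto `(←G, G)`; in
particular `←G` is the maximal equicontinuous factor of `(Ω_G(x), G)`. -/
theorem statement19 {G : Type*} [Group G] [Group.FG G] [TopologicalSpace G]
    [DiscreteTopology G]
    (Γ : ℕ → Subgroup G) (hdec : ∀ n, Γ (n + 1) ≤ Γ n) (hfin : ∀ n, (Γ n).FiniteIndex) :
    ∃ x : G → Bool, IsToeplitz x ∧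
      ∃ π : OmegaSub G x → Subodometer Γ,
        IsFactorMap G π ∧
        (∃ y : Subodometer Γ, ∃! z : OmegaSub G x, π z = y) ∧
        ∀ (Y : Type) (_ : MetricSpace Y) (_ : MulAction G Y),
          (∀ g : G, Continuous fun y : Y => g • y) →
          IsEquicontinuousSystem G Y →
          ∀ q : OmegaSub G x → Y, IsFactorMap G q →
            ∃ ψ : Subodometer Γ → Y, IsFactorMap G ψ ∧ ψ ∘ π = q := by
  have := countable_of_group_fg G
  have hΓ : Antitone Γ := antitone_nat_of_succ_le hdec
  obtain ⟨x, hconst, hrec⟩ := exists_recognizable_array Γ hΓ hfin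
  obtain ⟨π, hπ⟩ := exists_coset_map hdec hrec
  have hcont := continuous_of_coset_map hπ
  have hsurj := surjective_of_coset_map hπ
  have hsmul := map_smul_of_coset_map hπ
  refine ⟨x, fun g => ?_, π, ⟨hcont, hsurj, hsmul⟩, ⟨odoE Γ hdec, ⟨x, self_mem_omegaG G x⟩, ?_, ?_⟩,
    ?_⟩
  · obtain ⟨n, hn⟩ := hconst g
    exact ⟨Γ n, hfin n, Set.mem_iUnion.2 ⟨x g, hn⟩⟩
  · refine Subtype.ext (funext fun n => ?_)
    obtain ⟨F, hF⟩ := hπ n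
    exact hF _ 1 fun f _ => by rw [mul_one]
  · refine fun z hz => Subtype.ext (funext fun g => ?_)
    obtain ⟨N, hN⟩ := exists_apply_eq_of_coset_map hΓ hconst hπ g
    exact hN N le_rfl z (by rw [hz]; rfl)
  · intro Y _ _ _ hY q hq
    have hfib : ∀ z, q (Function.surjInv hsurj (π z)) = q z := fun z =>
      factor_eq_of_coset_map_eq hΓ hconst hπ hY hq (Function.surjInv_eq hsurj (π z))
    have hcomp : (fun y => q (Function.surjInv hsurj y)) ∘ π = q := funext hfib
    refine ⟨fun y => q (Function.surjInv hsurj y), ⟨?_, ?_, ?_⟩, hcomp⟩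
    · exact (hcont.isClosedMap.isQuotientMap hcont hsurj).continuous_iff.2 (hcomp.symm ▸ hq.1)
    · intro y
      obtain ⟨z, rfl⟩ := hq.2.1 y
      exact ⟨π z, hfib z⟩
    · intro g y
      obtain ⟨z, rfl⟩ := hsurj y
      beta_reduce
      rw [← hsmul, hfib, hfib, hq.2.2]
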